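/- Let S be an associative algebra over a field, let T be a subalgebra of S, and let Q = T + T·S. If S^n ⊆ Q for some n ≥ 1, then S^{nm} ⊆ T^m + T^m·S for every m ≥ 1. Consequently, if T is nilpotent and S^n ⊆ Q for some n ≥ 1, then S is nilpotent. -/

import Mathlib

/-- The span of all products `x * y` with `x ∈ T`, `y ∈ U`. -/
def submul {F E : Type*} [Field F] [AddCommGroup E] [Module F E] [Mul E]
    (T U : Submodule F E) : Submodule F E :=
  Submodule.span F {z | ∃ x ∈ T, ∃ y ∈ U, z = x * y}

/-- `pw T k = T^(k+1)`, the span of all products of `k+1` elements of `T`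
(left-normed; by associativity this is the usual power). -/
def pw {F E : Type*} [Field F] [AddCommGroup E] [Module F E] [Mul E]
    (T : Submodule F E) : ℕ → Submodule F E
  | 0 => T
  | k + 1 => submul (pw T k) T

section Submul

variable {F S : Type*} [Field F] [NonUnitalRing S] [Module F S]

theorem submul_le {A B C : Submodule F S} :
    submul A B ≤ C ↔ ∀ x ∈ A, ∀ y ∈ B, x * y ∈ C := by
  refine Submodule.span_le.trans ⟨fun h x hx y hy => h ⟨x, hx, y, hy, rfl⟩, ?_⟩
  rintro h _ ⟨x, hx, y, hy, rfl⟩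
  exact h x hx y hy

theorem mul_mem_submul {A B : Submodule F S} {x y : S} (hx : x ∈ A) (hy : y ∈ B) :
    x * y ∈ submul A B :=
  submul_le.1 le_rfl x hx y hy

theorem submul_mono {A B C D : Submodule F S} (h₁ : A ≤ C) (h₂ : B ≤ D) :
    submul A B ≤ submul C D :=
  submul_le.2 fun _ hx _ hy => mul_mem_submul (h₁ hx) (h₂ hy)

theorem bot_submul (A : Submodule F S) : submul ⊥ A = ⊥ := by
  refine le_bot_iff.1 (submul_le.2 fun x hx y _ => ?_)
  rw [(Submodule.mem_bot F).1 hx, zero_mul]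
  exact zero_mem _

theorem pw_top_succ_le (k : ℕ) : pw (⊤ : Submodule F S) (k + 1) ≤ pw ⊤ k := by
  induction k with
  | zero => exact le_top
  | succ k ih => exact submul_mono ih le_rfl

variable [SMulCommClass F S S] [IsScalarTower F S S]

theorem submul_eq_map₂ (A B : Submodule F S) :
    submul A B = Submodule.map₂ (LinearMap.mul F S) A B :=
  le_antisymm (submul_le.2 fun _ hx _ hy => Submodule.apply_mem_map₂ (LinearMap.mul F S) hx hy)
    (Submodule.map₂_le.2 fun _ hx _ hy => mul_mem_submul hx hy)

theorem sup_submul (A B C : Submodule F S) :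
    submul (A ⊔ B) C = submul A C ⊔ submul B C := by
  simp only [submul_eq_map₂, Submodule.map₂_sup_left]

theorem submul_sup (A B C : Submodule F S) :
    submul A (B ⊔ C) = submul A B ⊔ submul A C := by
  simp only [submul_eq_map₂, Submodule.map₂_sup_right]

theorem submul_assoc (A B C : Submodule F S) :
    submul (submul A B) C = submul A (submul B C) := by
  apply le_antisymm
  · refine submul_le.2 fun x hx z hz => ?_
    have h : submul A B ≤ (submul A (submul B C)).comap (LinearMap.mulRight F z) :=
      submul_le.2 fun a ha b hb => by
        simpa [mul_assoc] using mul_mem_submul ha (mul_mem_submul hb hz)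
    exact h hx
  · refine submul_le.2 fun x hx z hz => ?_
    have h : submul B C ≤ (submul (submul A B) C).comap (LinearMap.mulLeft F x) :=
      submul_le.2 fun b hb c hc => by
        simpa [mul_assoc] using mul_mem_submul (mul_mem_submul hx hb) hc
    exact h hz

theorem pw_add_succ (A : Submodule F S) (a b : ℕ) :
    pw A (a + b + 1) = submul (pw A a) (pw A b) := by
  induction b with
  | zero => rfl
  | succ b ih =>
    change submul (pw A (a + b + 1)) A = submul (pw A a) (submul (pw A b) A)
    rw [ih, submul_assoc]

theorem pw_top_mul_le {T : Submodule F S} {k : ℕ}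
    (hQ : pw (⊤ : Submodule F S) k ≤ T ⊔ submul T ⊤) (m : ℕ) :
    pw (⊤ : Submodule F S) ((k + 1) * m + k) ≤ pw T m ⊔ submul (pw T m) ⊤ := by
  induction m with
  | zero => simpa [pw] using hQ
  | succ m ih =>
    have top_submul : submul ⊤ (pw (⊤ : Submodule F S) k) ≤ pw ⊤ k := by
      refine le_trans (le_of_eq ?_) (pw_top_succ_le k)
      rw [← Nat.zero_add k, pw_add_succ, Nat.zero_add, pw]
    calc pw (⊤ : Submodule F S) ((k + 1) * (m + 1) + k)
        = submul (pw ⊤ ((k + 1) * m + k)) (pw ⊤ k) := by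
          rw [← pw_add_succ]; congr 1; ring
      _ ≤ submul (pw T m ⊔ submul (pw T m) ⊤) (pw ⊤ k) := submul_mono ih le_rfl
      _ = submul (pw T m) (pw ⊤ k) ⊔ submul (pw T m) (submul ⊤ (pw ⊤ k)) := by
          rw [sup_submul, submul_assoc]
      _ ≤ submul (pw T m) (T ⊔ submul T ⊤) :=
          sup_le (submul_mono le_rfl hQ) (submul_mono le_rfl (top_submul.trans hQ))
      _ = pw T (m + 1) ⊔ submul (pw T (m + 1)) ⊤ := by
          rw [submul_sup, ← submul_assoc, pw]

end Submul

/-- Let `S` be an associative algebra over a field, `T` a subalgebra and `Q = T + T·S`.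
If `Sⁿ ⊆ Q` for some `n ≥ 1`, then `S^(n·m) ⊆ Tᵐ + Tᵐ·S` for every `m ≥ 1`; consequently,
if moreover `T` is nilpotent, then `S` is nilpotent. -/
theorem pow_le_of_pow_le_right_ideal
    {F S : Type*} [Field F] [NonUnitalRing S] [Module F S]
    [SMulCommClass F S S] [IsScalarTower F S S]
    (T : Submodule F S) (hT : ∀ x ∈ T, ∀ y ∈ T, x * y ∈ T)
    (n : ℕ) (hn : 1 ≤ n)
    (hQ : pw (⊤ : Submodule F S) (n - 1) ≤ T ⊔ submul T ⊤) :
    (∀ m, 1 ≤ m →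
      pw (⊤ : Submodule F S) (n * m - 1) ≤ pw T (m - 1) ⊔ submul (pw T (m - 1)) ⊤) ∧
    ((∃ m, pw T m = ⊥) → ∃ N, pw (⊤ : Submodule F S) N = ⊥) := by
  obtain ⟨k, rfl⟩ := Nat.exists_eq_add_of_le' hn
  rw [Nat.add_sub_cancel] at hQ
  constructor
  · intro m hm
    obtain ⟨m, rfl⟩ := Nat.exists_eq_add_of_le' hm
    exact pw_top_mul_le hQ m
  · rintro ⟨m, hm⟩
    refine ⟨(k + 1) * m + k, le_bot_iff.1 ((pw_top_mul_le hQ m).trans ?_)⟩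
    rw [hm, bot_submul, sup_idem]
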